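/- Every partial combinatory algebra has a weak completion: for every pca A there exist a total combinatory algebra M and an injective map f : A → M such that whenever a·b is defined in A, f(a)·f(b) = f(a·b) in M. -/

import Mathlib

universe u

/-- Lifting of a partial application to `Part`, used to express Kleene equality
of composite terms such as `s·a·b·c ≃ (a·c)·(b·c)`. -/
def papp {A : Type*} (app : A → A → Part A) (x y : Part A) : Part A :=
  x.bind fun a => y.bind fun b => app a b

/-- `k` and `s` are combinators for the partial applicative structure `app`:
for all `a, b, c`: `k·a` is defined and `(k·a)·b = a`; `s·a` and `(s·a)·b` are
defined; and `((s·a)·b)·c ≃ (a·c)·(b·c)` (Kleene equality). -/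
def IsCombinators {A : Type*} (app : A → A → Part A) (k s : A) : Prop :=
  (∀ a, (app k a).Dom) ∧
  (∀ a b, papp app (app k a) (Part.some b) = Part.some a) ∧
  (∀ a, (app s a).Dom) ∧
  (∀ a b, (papp app (app s a) (Part.some b)).Dom) ∧
  (∀ a b c, papp app (papp app (app s a) (Part.some b)) (Part.some c)
      = papp app (app a c) (app b c))

/-- A partial combinatory algebra: a nontrivial set with a partial binary
application admitting combinators `k`, `s`. -/
def IsPCA {A : Type*} (app : A → A → Part A) : Prop :=
  (∃ a b : A, a ≠ b) ∧ ∃ k s : A, IsCombinators app k s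

/-- The points of Engeler's graph model over `A`: atoms, and arrows `β ⟶ c` from a finite list
of points to a point. -/
inductive EngelerPoint (A : Type u) : Type u
  | atom : A → EngelerPoint A
  | arrow : List (EngelerPoint A) → EngelerPoint A → EngelerPoint A

namespace EngelerPoint

variable {A : Type u}

/-- Application in the graph model: `X · Y` consists of the `c` for which some arrow `β ⟶ c`
with `β ⊆ Y` belongs to `X`. -/
def apply (X Y : Set (EngelerPoint A)) : Set (EngelerPoint A) :=
  {c | ∃ β : List (EngelerPoint A), (∀ x ∈ β, x ∈ Y) ∧ arrow β c ∈ X}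

theorem apply_mono {X X' Y Y' : Set (EngelerPoint A)} (hX : X ⊆ X') (hY : Y ⊆ Y') :
    apply X Y ⊆ apply X' Y' := by
  rintro c ⟨β, hβ, hc⟩
  exact ⟨β, fun x hx => hY (hβ x hx), hX hc⟩

/-- Finitely many elements of `X · Y` already belong to the application of finite parts of
`X` and `Y`. -/
theorem exists_lists_of_forall_mem_apply {X Y : Set (EngelerPoint A)}
    (δ : List (EngelerPoint A)) (h : ∀ d ∈ δ, d ∈ apply X Y) :
    ∃ β γ : List (EngelerPoint A), (∀ x ∈ β, x ∈ X) ∧ (∀ y ∈ γ, y ∈ Y) ∧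
      ∀ d ∈ δ, d ∈ apply {x | x ∈ β} {y | y ∈ γ} := by
  induction δ with
  | nil => exact ⟨[], [], by simp, by simp, by simp⟩
  | cons d δ ih =>
    obtain ⟨β, γ, hβ, hγ, hδ⟩ := ih fun e he => h e (List.mem_cons_of_mem _ he)
    obtain ⟨ε, hε, hd⟩ := h d List.mem_cons_self
    refine ⟨arrow ε d :: β, ε ++ γ, ?_, ?_, ?_⟩
    · simpa using ⟨hd, hβ⟩
    · intro y hy
      exact (List.mem_append.1 hy).elim (hε y) (hγ y)
    · intro e he
      rcases List.mem_cons.1 he with rfl | he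
      · exact ⟨ε, fun x hx => List.mem_append_left _ hx, List.mem_cons_self⟩
      · exact apply_mono (fun x hx => List.mem_cons_of_mem _ hx)
          (fun y hy => List.mem_append_right _ hy) (hδ e he)

/-- The combinator `k` of the graph model. -/
def combK (A : Type u) : Set (EngelerPoint A) :=
  {p | ∃ β γ c, p = arrow β (arrow γ c) ∧ c ∈ β}

/-- The combinator `s` of the graph model. -/
def combS (A : Type u) : Set (EngelerPoint A) :=
  {p | ∃ α β γ c, p = arrow α (arrow β (arrow γ c)) ∧
    c ∈ apply (apply {x | x ∈ α} {x | x ∈ γ}) (apply {x | x ∈ β} {x | x ∈ γ})}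

theorem apply_combK (X Y : Set (EngelerPoint A)) : apply (apply (combK A) X) Y = X := by
  ext c
  constructor
  · rintro ⟨γ, -, β, hβ, _, _, _, h, hc⟩
    cases h
    exact hβ _ hc
  · intro hc
    exact ⟨[], by simp, [c], by simpa using hc, [c], [], c, rfl, by simp⟩

theorem apply_combS (X Y Z : Set (EngelerPoint A)) :
    apply (apply (apply (combS A) X) Y) Z = apply (apply X Z) (apply Y Z) := by
  ext c
  constructor
  · rintro ⟨γ, hγ, β, hβ, α, hα, _, _, _, _, h, hc⟩
    cases h
    exact apply_mono (apply_mono hα hγ) (apply_mono hβ hγ) hc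
  · rintro ⟨δ, hδ, ε, hε, hc⟩
    obtain ⟨β, γ, hβ, hγ, hδ'⟩ := exists_lists_of_forall_mem_apply δ hδ
    refine ⟨ε ++ γ, fun y hy => (List.mem_append.1 hy).elim (hε y) (hγ y), β, hβ,
      [arrow ε (arrow δ c)], by simpa using hc, _, _, _, _, rfl, δ, fun d hd => ?_,
      ε, fun x hx => List.mem_append_left _ hx, by simp⟩
    exact apply_mono subset_rfl (fun y hy => List.mem_append_right _ hy) (hδ' d hd)

/-- Membership in the set of points representing an element `a` of a partial applicative
structure: the atom `a` itself, and the arrows `[b] ⟶ c` with `c` representing `a · b`. -/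
inductive Represents (app : A → A → Part A) : A → EngelerPoint A → Prop
  | atom (a : A) : Represents app a (atom a)
  | arrow {a b x : A} {c : EngelerPoint A} :
      x ∈ app a b → Represents app x c → Represents app a (arrow [.atom b] c)

theorem represents_atom_iff {app : A → A → Part A} {a b : A} :
    Represents app a (.atom b) ↔ a = b := by
  constructor
  · intro h
    cases h
    rfl
  · rintro rfl
    exact .atom _

theorem apply_represents {app : A → A → Part A} {a b x : A} (hx : x ∈ app a b) :
    apply {p | Represents app a p} {p | Represents app b p} = {p | Represents app x p} := by
  ext c
  constructor
  · rintro ⟨β, hβ, h⟩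
    cases h with
    | arrow hy hc =>
      obtain rfl := represents_atom_iff.1 (hβ _ List.mem_cons_self)
      obtain rfl := Part.mem_unique hx hy
      exact hc
  · intro hc
    exact ⟨[.atom b], by simpa using Represents.atom b, .arrow hx hc⟩

end EngelerPoint

/-- Every partial combinatory algebra has a weak completion:
for every pca `A` there exist a (nontrivial) total combinatory algebra `M` and
an injection `f : A → M` such that `a·b↓ = x` in `A` implies
`f a · f b = f x` in `M`. -/
theorem pca_has_weak_completion {A : Type u} (app : A → A → Part A)
    (hA : IsPCA app) :
    ∃ (M : Type u) (appM : M → M → M) (f : A → M),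
      (∃ x y : M, x ≠ y) ∧
      (∃ k s : M, (∀ a b : M, appM (appM k a) b = a) ∧
        (∀ a b c : M, appM (appM (appM s a) b) c = appM (appM a c) (appM b c))) ∧
      Function.Injective f ∧
      (∀ a b x : A, x ∈ app a b → appM (f a) (f b) = f x) := by
  obtain ⟨⟨a₀, -, -⟩, -⟩ := hA
  refine ⟨Set (EngelerPoint A), EngelerPoint.apply,
    fun a => {p | EngelerPoint.Represents app a p},
    ⟨∅, {.atom a₀}, (Set.singleton_ne_empty _).symm⟩,
    ⟨EngelerPoint.combK A, EngelerPoint.combS A, EngelerPoint.apply_combK,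
      EngelerPoint.apply_combS⟩, ?_, fun _ _ _ => EngelerPoint.apply_represents⟩
  intro a b hab
  have h := (Set.ext_iff.1 hab (.atom a)).1 (EngelerPoint.Represents.atom a)
  exact (EngelerPoint.represents_atom_iff.1 h).symm
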